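/- Let q = 3 (so λ = 1) and let α ∈ [√2 − 1, 1/2]. Let μ be the Borel measure on ℝ² with density (1 + xy)^{−2} with respect to two-dimensional Lebesgue measure, and let μ_{1/2} and μ_α be the restrictions of μ to Ω_{1/2} and to Ω_α respectively, where l_1 = (2α−1)/(1−α), r_1 = (1−2α)/α, and Ω_α = ([α−1, l_1) × [0, g²)) ∪ ([l_1, r_1) × ([0, g²) ∪ [1/2, g))) ∪ ([r_1, α) × [0, g)). Then the systems (𝒯_{1/2}, Ω_{1/2}, μ_{1/2}) and (𝒯_α, Ω_α, μ_α) are isomorphic: there exist measurable maps f, f' : ℝ² → ℝ² such that the pushforward of μ_{1/2} under f is μ_α, the pushforward of μ_α under f' is μ_{1/2}, f'(f(z)) = z for μ_{1/2}-almost every z, f(f'(w)) = w for μ_α-almost every w, and f(𝒯_{1/2}(z)) = 𝒯_α(f(z)) for μ_{1/2}-almost every z ∈ Ω_{1/2}. -/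

import Mathlib

open Real MeasureTheory Set

/-- The digit function `d_α(x) = ⌊|1/(λx)| + 1 − α⌋`. -/
noncomputable def rosenD (lam a x : ℝ) : ℤ := ⌊|1 / (lam * x)| + 1 - a⌋

/-- The α-Rosen map `T_α`. -/
noncomputable def rosenT (lam a : ℝ) (x : ℝ) : ℝ :=
  if x = 0 then 0 else |1 / x| - lam * rosenD lam a x

/-- The planar map `𝒯_α(x,y) = (T_α(x), 1/(d_α(x)λ + ε(x)·y))`. -/
noncomputable def rosenTT (lam a : ℝ) (z : ℝ × ℝ) : ℝ × ℝ :=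
  (rosenT lam a z.1, 1 / ((rosenD lam a z.1 : ℝ) * lam + Real.sign z.1 * z.2))

/-- The small golden number `g = (√5 − 1)/2`. -/
noncomputable def gold : ℝ := (Real.sqrt 5 - 1) / 2

/-- The NICF natural-extension domain `Ω_{1/2}` for `q = 3`. -/
noncomputable def Omega3 : Set (ℝ × ℝ) :=
  Set.Ico (-(1 : ℝ) / 2) 0 ×ˢ Set.Ico (0 : ℝ) (gold ^ 2) ∪
    Set.Ico (0 : ℝ) (1 / 2) ×ˢ Set.Ico (0 : ℝ) gold

/-- The region of changed digits `C`. -/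
noncomputable def changedDigits (lam a : ℝ) (Om : Set (ℝ × ℝ)) : Set (ℝ × ℝ) :=
  {z ∈ Om | z.1 ≠ 0 ∧ z.1 ∈ Set.Ico ((a - 1) * lam) (a * lam) ∧
    z.1 ∈ Set.Ico ((1 / 2 - 1) * lam) (1 / 2 * lam) ∧
    rosenD lam a z.1 ≠ rosenD lam (1 / 2) z.1}

/-- The density `(1 + xy)⁻²`, as a measure on the plane. -/
noncomputable def rosenMeasure : Measure (ℝ × ℝ) :=
  volume.withDensity fun z => ENNReal.ofReal (((1 + z.1 * z.2) ^ 2)⁻¹)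

lemma det_prodMap_smulRight (c d : ℝ) :
    (((c • ContinuousLinearMap.id ℝ ℝ).prodMap (d • ContinuousLinearMap.id ℝ ℝ) :
      ℝ × ℝ →L[ℝ] ℝ × ℝ)).det = c * d := by
  rw [ContinuousLinearMap.det, ContinuousLinearMap.coe_prodMap, LinearMap.det_prodMap]
  simp

/-- A product map satisfying the Jacobian identity transports `rosenMeasure`. -/
lemma map_restrict_rosenMeasure {F : ℝ × ℝ → ℝ × ℝ} {p q p' q' : ℝ → ℝ} {S R : Set (ℝ × ℝ)}
    (hF : Measurable F) (hFpq : ∀ z, F z = (p z.1, q z.2)) (hS : MeasurableSet S)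
    (hinj : InjOn F S) (himg : F '' S = R)
    (hp : ∀ z ∈ S, HasDerivAt p (p' z.1) z.1) (hq : ∀ z ∈ S, HasDerivAt q (q' z.2) z.2)
    (hjac : ∀ z ∈ S, |p' z.1 * q' z.2| * ((1 + p z.1 * q z.2) ^ 2)⁻¹
      = ((1 + z.1 * z.2) ^ 2)⁻¹) :
    (rosenMeasure.restrict S).map F = rosenMeasure.restrict R := by
  ext B hB
  have hSB : MeasurableSet (F ⁻¹' B ∩ S) := (hF hB).inter hS
  have himgB : B ∩ R = F '' (F ⁻¹' B ∩ S) := by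
    rw [← himg, image_preimage_inter]
  have hderiv : ∀ z ∈ F ⁻¹' B ∩ S, HasFDerivWithinAt F
      ((p' z.1 • ContinuousLinearMap.id ℝ ℝ).prodMap (q' z.2 • ContinuousLinearMap.id ℝ ℝ))
      (F ⁻¹' B ∩ S) z := by
    intro z hz
    have h1 := (hp z hz.2).hasFDerivAt
    have h2 := (hq z hz.2).hasFDerivAt
    have h3 : HasFDerivAt (Prod.map p q) _ z := HasFDerivAt.prodMap z h1 h2
    have hFe : F = Prod.map p q := funext hFpq
    rw [hFe]
    convert h3.hasFDerivWithinAt using 2 <;> ext <;> simp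
  have hRB : MeasurableSet (F '' (F ⁻¹' B ∩ S)) :=
    measurable_image_of_fderivWithin hSB hderiv (hinj.mono inter_subset_right)
  rw [Measure.map_apply hF hB, Measure.restrict_apply (hF hB), Measure.restrict_apply hB, himgB,
    rosenMeasure, withDensity_apply _ hSB, withDensity_apply _ hRB,
    lintegral_image_eq_lintegral_abs_det_fderiv_mul volume hSB hderiv
      (hinj.mono inter_subset_right)]
  refine setLIntegral_congr_fun hSB fun z hz => ?_
  rw [det_prodMap_smulRight, ← ENNReal.ofReal_mul (abs_nonneg _), hFpq z, hjac z hz.2]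

lemma gold_sq : gold ^ 2 = 1 - gold := by
  have h : Real.sqrt 5 ^ 2 = 5 := Real.sq_sqrt (by norm_num)
  unfold gold
  linarith [h]

lemma half_lt_gold : 1 / 2 < gold := by
  have : (2 : ℝ) < Real.sqrt 5 := Real.lt_sqrt_of_sq_lt (by norm_num)
  unfold gold
  linarith

lemma gold_lt_two_thirds : gold < 2 / 3 := by
  have : Real.sqrt 5 < 7 / 3 := by
    rw [Real.sqrt_lt' (by norm_num)]; norm_num
  unfold gold
  linarith

/-- The quilting map taking the strip `[α, 1/2)` to `[α - 1, -1/2)`. -/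
noncomputable def quiltShift (z : ℝ × ℝ) : ℝ × ℝ := (z.1 - 1, z.2 / (1 + z.2))

/-- The involution relating the first images of the two quilted strips. -/
noncomputable def quiltFlip (z : ℝ × ℝ) : ℝ × ℝ := (-z.1 / (1 + z.1), 1 - z.2)

lemma measurable_quiltShift : Measurable quiltShift := by
  unfold quiltShift; fun_prop

lemma measurable_quiltFlip : Measurable quiltFlip := by
  unfold quiltFlip; fun_prop

lemma quiltFlip_quiltFlip {z : ℝ × ℝ} (hz : 1 + z.1 ≠ 0) : quiltFlip (quiltFlip z) = z := by
  have : 1 + -z.1 / (1 + z.1) = 1 / (1 + z.1) := by field_simp; ring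
  ext
  · simp only [quiltFlip, this]
    field_simp
  · simp [quiltFlip]

/-- The points of `Omega3` whose first coordinate exceeds `a`. -/
def removedStrip (a : ℝ) : Set (ℝ × ℝ) := Ioo a (1 / 2) ×ˢ Ioo 0 gold

/-- The image of `removedStrip a` under the map with parameter `1/2`. -/
def removedBlock (a : ℝ) : Set (ℝ × ℝ) := Ioo 0 ((1 - 2 * a) / a) ×ˢ Ioo (gold ^ 2) (1 / 2)

open Classical in
/-- The isomorphism from the system with parameter `1/2` to that with parameter `a`. -/
noncomputable def quilt (a : ℝ) (z : ℝ × ℝ) : ℝ × ℝ :=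
  if a ≤ z.1 then quiltShift z
  else if z ∈ removedBlock a then quiltFlip z else z

open Classical in
/-- The inverse of `quilt a`. -/
noncomputable def unquilt (z : ℝ × ℝ) : ℝ × ℝ :=
  if z.1 < -1 / 2 then (z.1 + 1, z.2 / (1 - z.2))
  else if z ∈ Iio 0 ×ˢ Ioi (1 / 2) then quiltFlip z else z

lemma measurable_quilt (a : ℝ) : Measurable (quilt a) :=
  Measurable.ite (measurableSet_le measurable_const measurable_fst) measurable_quiltShift
    (Measurable.ite (measurableSet_Ioo.prod measurableSet_Ioo) measurable_quiltFlip measurable_id)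

lemma measurable_unquilt : Measurable unquilt :=
  Measurable.ite (measurableSet_lt measurable_fst measurable_const) (by fun_prop)
    (Measurable.ite (measurableSet_Iio.prod measurableSet_Ioi) measurable_quiltFlip measurable_id)

/-- The image of `removedStrip a` under `quiltShift`. -/
def addedStrip (a : ℝ) : Set (ℝ × ℝ) := Ioo (a - 1) (-1 / 2) ×ˢ Ioo 0 (gold ^ 2)

/-- The image of `removedBlock a` under `quiltFlip`. -/
def addedBlock (a : ℝ) : Set (ℝ × ℝ) := Ioo ((2 * a - 1) / (1 - a)) 0 ×ˢ Ioo (1 / 2) gold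

/-- The common part of the two natural extension domains, up to a null set. -/
def commonPart (a : ℝ) : Set (ℝ × ℝ) :=
  Ioo (-1 / 2) 0 ×ˢ Ioo 0 (gold ^ 2) ∪
    Ioo 0 ((1 - 2 * a) / a) ×ˢ (Ioo 0 (gold ^ 2) ∪ Ioo (1 / 2) gold) ∪
    Ioo ((1 - 2 * a) / a) a ×ˢ Ioo 0 gold

lemma measurableSet_commonPart (a : ℝ) : MeasurableSet (commonPart a) :=
  ((measurableSet_Ioo.prod measurableSet_Ioo).union
    (measurableSet_Ioo.prod (measurableSet_Ioo.union measurableSet_Ioo))).union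
    (measurableSet_Ioo.prod measurableSet_Ioo)

lemma map_quiltShift (a : ℝ) :
    (rosenMeasure.restrict (removedStrip a)).map quiltShift
      = rosenMeasure.restrict (addedStrip a) := by
  have hg := gold_sq
  have hg1 := half_lt_gold
  refine map_restrict_rosenMeasure (p := fun x => x - 1) (q := fun y => y / (1 + y))
    (p' := fun _ => 1) (q' := fun y => ((1 + y) ^ 2)⁻¹) measurable_quiltShift (fun z => rfl)
    (measurableSet_Ioo.prod measurableSet_Ioo) ?_ ?_ ?_ ?_ ?_
  · rintro ⟨x, y⟩ ⟨hx, hy⟩ ⟨u, v⟩ ⟨hu, hv⟩ h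
    simp only [quiltShift, Prod.mk.injEq, mem_Ioo] at *
    have h1 : 1 + y ≠ 0 := by linarith [hy.1]
    have h2 : 1 + v ≠ 0 := by linarith [hv.1]
    have h3 := h.2
    rw [div_eq_div_iff h1 h2] at h3
    exact ⟨by linarith [h.1], by linarith⟩
  · ext ⟨u, v⟩
    constructor
    · rintro ⟨⟨x, y⟩, ⟨⟨hx1, hx2⟩, hy1, hy2⟩, h⟩
      simp only [quiltShift, Prod.mk.injEq] at *
      obtain ⟨rfl, rfl⟩ := h
      refine ⟨⟨?_, ?_⟩, ?_, ?_⟩ <;> simp only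
      · linarith
      · linarith
      · positivity
      · rw [div_lt_iff₀ (by linarith)]
        nlinarith
    · rintro ⟨⟨hx1, hx2⟩, hy1, hy2⟩
      simp only at *
      have h1 : 0 < 1 - v := by linarith
      refine ⟨(u + 1, v / (1 - v)), ⟨⟨?_, ?_⟩, ?_, ?_⟩, ?_⟩ <;> try simp only
      · linarith
      · linarith
      · positivity
      · rw [div_lt_iff₀ (by linarith)]
        nlinarith
      · have h2 : 1 + v / (1 - v) = 1 / (1 - v) := by field_simp; ring
        ext <;> simp only [quiltShift, h2]
        · ring
        · field_simp
  · rintro z -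
    exact (hasDerivAt_id z.1).sub_const 1
  · rintro z ⟨-, hz, -⟩
    have h1 : 1 + z.2 ≠ 0 := by linarith
    refine ((hasDerivAt_id' z.2).fun_div ((hasDerivAt_id' z.2).const_add 1) h1).congr_deriv ?_
    field_simp
    ring
  · rintro z ⟨-, hz, -⟩
    have h1 : 0 < 1 + z.2 := by linarith
    have h2 : 1 + (z.1 - 1) * (z.2 / (1 + z.2)) = (1 + z.1 * z.2) / (1 + z.2) := by
      field_simp; ring
    rw [h2, abs_of_pos (by positivity)]
    field_simp

lemma map_quiltFlip {a : ℝ} (ha0 : 0 < a) (ha1 : a ≤ 1 / 2) :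
    (rosenMeasure.restrict (removedBlock a)).map quiltFlip
      = rosenMeasure.restrict (addedBlock a) := by
  have hg := gold_sq
  have h1a : 0 < 1 - a := by linarith
  refine map_restrict_rosenMeasure (p := fun x => -x / (1 + x)) (q := fun y => 1 - y)
    (p' := fun x => -((1 + x) ^ 2)⁻¹) (q' := fun y => -1) measurable_quiltFlip (fun z => rfl)
    (measurableSet_Ioo.prod measurableSet_Ioo) ?_ ?_ ?_ ?_ ?_
  · intro z hz w hw h
    have hz' : 1 + z.1 ≠ 0 := by linarith [hz.1.1]
    have hw' : 1 + w.1 ≠ 0 := by linarith [hw.1.1]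
    rw [← quiltFlip_quiltFlip hz', h, quiltFlip_quiltFlip hw']
  · ext w
    constructor
    · rintro ⟨⟨x, y⟩, ⟨⟨hx1, hx2⟩, hy1, hy2⟩, rfl⟩
      simp only [quiltFlip] at *
      rw [lt_div_iff₀ ha0] at hx2
      refine ⟨⟨?_, ?_⟩, ?_, ?_⟩ <;> simp only
      · rw [div_lt_div_iff₀ (by linarith) (by linarith)]
        nlinarith
      · rw [div_lt_iff₀ (by linarith)]
        linarith
      · linarith
      · linarith
    · rintro ⟨⟨hx1, hx2⟩, hy1, hy2⟩
      rw [div_lt_iff₀ h1a] at hx1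
      have h1 : 0 < 1 + w.1 := by nlinarith
      refine ⟨quiltFlip w, ⟨⟨?_, ?_⟩, ?_, ?_⟩, quiltFlip_quiltFlip h1.ne'⟩ <;>
        simp only [quiltFlip]
      · exact div_pos (by linarith) h1
      · rw [div_lt_div_iff₀ h1 ha0]
        nlinarith
      · linarith
      · linarith
  · rintro z ⟨⟨hz, -⟩, -⟩
    have h1 : 1 + z.1 ≠ 0 := by linarith
    refine ((hasDerivAt_id' z.1).fun_neg.fun_div
      ((hasDerivAt_id' z.1).const_add 1) h1).congr_deriv ?_
    field_simp
    ring
  · rintro z -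
    exact (hasDerivAt_id z.2).const_sub 1
  · rintro z ⟨⟨hz, -⟩, -⟩
    have h1 : 0 < 1 + z.1 := by linarith
    have h2 : 1 + -z.1 / (1 + z.1) * (1 - z.2) = (1 + z.1 * z.2) / (1 + z.1) := by
      field_simp; ring
    rw [h2, neg_mul_neg, mul_one, abs_of_pos (by positivity)]
    field_simp

lemma ae_rosenMeasure_fst_ne (c : ℝ) : ∀ᵐ z ∂rosenMeasure, z.1 ≠ c :=
  (withDensity_absolutelyContinuous _ _).ae_le <|
    Measure.quasiMeasurePreserving_fst.ae (Measure.ae_ne volume c)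

lemma ae_rosenMeasure_snd_ne (c : ℝ) : ∀ᵐ z ∂rosenMeasure, z.2 ≠ c :=
  (withDensity_absolutelyContinuous _ _).ae_le <|
    Measure.quasiMeasurePreserving_snd.ae (Measure.ae_ne volume c)

/-- The first coordinates of the boundaries of the two domains are ordered as expected. -/
lemma quilt_parameter_bounds {a : ℝ} (ha0 : Real.sqrt 2 - 1 ≤ a) (ha1 : a ≤ 1 / 2) :
    2 / 5 < a ∧ 0 ≤ (1 - 2 * a) / a ∧ (1 - 2 * a) / a ≤ a ∧ -1 / 2 < (2 * a - 1) / (1 - a) ∧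
      (2 * a - 1) / (1 - a) ≤ 0 := by
  have hs : (7 / 5 : ℝ) < Real.sqrt 2 := Real.lt_sqrt_of_sq_lt (by norm_num)
  have hs2 : Real.sqrt 2 ^ 2 = 2 := Real.sq_sqrt (by norm_num)
  have ha : 2 / 5 < a := by linarith
  refine ⟨ha, div_nonneg (by linarith) (by linarith), ?_, ?_,
    div_nonpos_of_nonpos_of_nonneg (by linarith) (by linarith)⟩
  · rw [div_le_iff₀ (by linarith)]
    nlinarith
  · rw [lt_div_iff₀ (by linarith)]
    linarith

lemma Omega3_ae_eq {a : ℝ} (ha0 : Real.sqrt 2 - 1 ≤ a) (ha1 : a ≤ 1 / 2) :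
    Omega3 =ᵐ[rosenMeasure] (removedStrip a ∪ removedBlock a ∪ commonPart a : Set (ℝ × ℝ)) := by
  obtain ⟨h1, h2, h3, -, -⟩ := quilt_parameter_bounds ha0 ha1
  have hg := gold_sq
  have hg1 := half_lt_gold
  have hg2 := gold_lt_two_thirds
  rw [Filter.eventuallyEq_set]
  filter_upwards [ae_rosenMeasure_fst_ne (-1 / 2), ae_rosenMeasure_fst_ne 0,
    ae_rosenMeasure_fst_ne ((1 - 2 * a) / a), ae_rosenMeasure_fst_ne a,
    ae_rosenMeasure_snd_ne 0, ae_rosenMeasure_snd_ne (gold ^ 2), ae_rosenMeasure_snd_ne (1 / 2)]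
    with z k1 k2 k3 k4 k5 k6 k7
  simp only [Omega3, removedStrip, removedBlock, commonPart, mem_union, mem_prod, mem_Ioo, mem_Ico]
  grind

lemma region_ae_eq {a : ℝ} (ha0 : Real.sqrt 2 - 1 ≤ a) (ha1 : a ≤ 1 / 2) :
    (Ico (a - 1) ((2 * a - 1) / (1 - a)) ×ˢ Ico (0 : ℝ) (gold ^ 2) ∪
        Ico ((2 * a - 1) / (1 - a)) ((1 - 2 * a) / a) ×ˢ
          (Ico (0 : ℝ) (gold ^ 2) ∪ Ico (1 / 2 : ℝ) gold) ∪
        Ico ((1 - 2 * a) / a) a ×ˢ Ico (0 : ℝ) gold : Set (ℝ × ℝ)) =ᵐ[rosenMeasure]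
      (addedStrip a ∪ addedBlock a ∪ commonPart a : Set (ℝ × ℝ)) := by
  obtain ⟨h1, h2, h3, h4, h5⟩ := quilt_parameter_bounds ha0 ha1
  rw [Filter.eventuallyEq_set]
  filter_upwards [ae_rosenMeasure_fst_ne (-1 / 2), ae_rosenMeasure_fst_ne 0,
    ae_rosenMeasure_fst_ne ((1 - 2 * a) / a), ae_rosenMeasure_fst_ne (a - 1),
    ae_rosenMeasure_fst_ne ((2 * a - 1) / (1 - a)),
    ae_rosenMeasure_snd_ne 0, ae_rosenMeasure_snd_ne (gold ^ 2), ae_rosenMeasure_snd_ne (1 / 2)]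
    with z k1 k2 k3 k4 k5 k6 k7 k8
  simp only [addedStrip, addedBlock, commonPart, mem_union, mem_prod, mem_Ioo, mem_Ico]
  grind

lemma quilt_of_mem_removedStrip {a : ℝ} {z : ℝ × ℝ} (hz : z ∈ removedStrip a) :
    quilt a z = quiltShift z :=
  if_pos hz.1.1.le

lemma quilt_of_mem_removedBlock {a : ℝ} (ha0 : Real.sqrt 2 - 1 ≤ a) (ha1 : a ≤ 1 / 2)
    {z : ℝ × ℝ} (hz : z ∈ removedBlock a) : quilt a z = quiltFlip z := by
  have h := (quilt_parameter_bounds ha0 ha1).2.2.1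
  rw [quilt, if_neg (by linarith [hz.1.2]), if_pos hz]

lemma bounds_of_mem_commonPart {a : ℝ} (ha0 : Real.sqrt 2 - 1 ≤ a) (ha1 : a ≤ 1 / 2)
    {z : ℝ × ℝ} (hz : z ∈ commonPart a) :
    -1 / 2 < z.1 ∧ z.1 ≠ 0 ∧ z.1 < a ∧ 0 < z.2 ∧ z.2 < gold ∧ (z.1 < 0 → z.2 < gold ^ 2) ∧
      z ∉ removedBlock a := by
  obtain ⟨h1, h2, h3, -, -⟩ := quilt_parameter_bounds ha0 ha1
  have hg := gold_sq
  have hg1 := half_lt_gold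
  simp only [removedBlock, commonPart, mem_union, mem_prod, mem_Ioo] at hz ⊢
  grind

lemma quilt_of_mem_commonPart {a : ℝ} (ha0 : Real.sqrt 2 - 1 ≤ a) (ha1 : a ≤ 1 / 2)
    {z : ℝ × ℝ} (hz : z ∈ commonPart a) : quilt a z = z := by
  obtain ⟨-, -, h1, -, -, -, h2⟩ := bounds_of_mem_commonPart ha0 ha1 hz
  rw [quilt, if_neg (by linarith), if_neg h2]

lemma map_quilt {a : ℝ} (ha0 : Real.sqrt 2 - 1 ≤ a) (ha1 : a ≤ 1 / 2) :
    (rosenMeasure.restrict (removedStrip a ∪ removedBlock a ∪ commonPart a)).map (quilt a)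
      = rosenMeasure.restrict (addedStrip a ∪ addedBlock a ∪ commonPart a) := by
  obtain ⟨h1, h2, h3, h4, h5⟩ := quilt_parameter_bounds ha0 ha1
  have hg := gold_sq
  have hg1 := half_lt_gold
  have mRS : MeasurableSet (removedStrip a) := measurableSet_Ioo.prod measurableSet_Ioo
  have mRB : MeasurableSet (removedBlock a) := measurableSet_Ioo.prod measurableSet_Ioo
  have mAB : MeasurableSet (addedBlock a) := measurableSet_Ioo.prod measurableSet_Ioo
  have mE := measurableSet_commonPart a
  have d1 : Disjoint (removedStrip a) (removedBlock a) := by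
    rw [disjoint_left]
    intro z hz hw
    linarith [hz.1.1, hw.1.2]
  have d2 : Disjoint (removedStrip a ∪ removedBlock a) (commonPart a) := by
    rw [disjoint_left]
    rintro z (hz | hz) hw
    · linarith [hz.1.1, (bounds_of_mem_commonPart ha0 ha1 hw).2.2.1]
    · exact (bounds_of_mem_commonPart ha0 ha1 hw).2.2.2.2.2.2 hz
  have d3 : Disjoint (addedStrip a) (addedBlock a) := by
    rw [disjoint_left]
    intro z hz hw
    linarith [hz.1.2, hw.1.1]
  have d4 : Disjoint (addedStrip a ∪ addedBlock a) (commonPart a) := by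
    rw [disjoint_left]
    rintro z (hz | hz) hw
    · linarith [hz.1.2, (bounds_of_mem_commonPart ha0 ha1 hw).1]
    · linarith [hz.2.1, (bounds_of_mem_commonPart ha0 ha1 hw).2.2.2.2.2.1 hz.1.2]
  have e1 : (rosenMeasure.restrict (removedStrip a)).map (quilt a)
      = rosenMeasure.restrict (addedStrip a) := by
    rw [← map_quiltShift]
    exact Measure.map_congr (ae_restrict_of_forall_mem mRS fun z => quilt_of_mem_removedStrip)
  have e2 : (rosenMeasure.restrict (removedBlock a)).map (quilt a)
      = rosenMeasure.restrict (addedBlock a) := by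
    rw [← map_quiltFlip (by linarith) ha1]
    exact Measure.map_congr
      (ae_restrict_of_forall_mem mRB fun z => quilt_of_mem_removedBlock ha0 ha1)
  have e3 : (rosenMeasure.restrict (commonPart a)).map (quilt a)
      = rosenMeasure.restrict (commonPart a) := by
    conv_rhs => rw [← Measure.map_id (μ := rosenMeasure.restrict (commonPart a))]
    exact Measure.map_congr
      (ae_restrict_of_forall_mem mE fun z => quilt_of_mem_commonPart ha0 ha1)
  rw [Measure.restrict_union d2 mE, Measure.restrict_union d1 mRB,
    Measure.restrict_union d4 mE, Measure.restrict_union d3 mAB,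
    Measure.map_add _ _ (measurable_quilt a), Measure.map_add _ _ (measurable_quilt a), e1, e2, e3]

lemma unquilt_quilt {a : ℝ} (ha0 : Real.sqrt 2 - 1 ≤ a) (ha1 : a ≤ 1 / 2) {z : ℝ × ℝ}
    (hz : z ∈ removedStrip a ∪ removedBlock a ∪ commonPart a) : unquilt (quilt a z) = z := by
  obtain ⟨h1, h2, h3, -, -⟩ := quilt_parameter_bounds ha0 ha1
  have hg := gold_sq
  have hg1 := half_lt_gold
  rcases hz with (hz | hz) | hz
  · rw [quilt_of_mem_removedStrip hz]
    obtain ⟨⟨-, hx⟩, hy, -⟩ := hz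
    rw [unquilt, if_pos (by simp only [quiltShift]; linarith)]
    have h4 : 1 - z.2 / (1 + z.2) = 1 / (1 + z.2) := by field_simp; ring
    ext <;> simp only [quiltShift, h4]
    · ring
    · field_simp
  · rw [quilt_of_mem_removedBlock ha0 ha1 hz]
    obtain ⟨⟨hx, hx'⟩, hy, hy'⟩ := hz
    have h4 : 0 < 1 + z.1 := by linarith
    rw [unquilt, if_neg, if_pos, quiltFlip_quiltFlip h4.ne']
    · refine ⟨div_neg_of_neg_of_pos (by linarith) h4, ?_⟩
      simp only [quiltFlip, mem_Ioi]
      linarith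
    · simp only [quiltFlip]
      rw [not_lt, div_le_div_iff₀ (by norm_num) h4]
      linarith
  · rw [quilt_of_mem_commonPart ha0 ha1 hz]
    obtain ⟨k1, -, -, -, -, k2, -⟩ := bounds_of_mem_commonPart ha0 ha1 hz
    rw [unquilt, if_neg (by linarith), if_neg]
    rintro ⟨k3, k4⟩
    simp only [mem_Ioi, mem_Iio] at k3 k4
    linarith [k2 k3]

lemma rosenT_eq {a x : ℝ} (hx : x ≠ 0) : rosenT 1 a x = |1 / x| - rosenD 1 a x := by
  simp [rosenT, hx]

lemma rosenT_half_mem {x : ℝ} (hx : x ≠ 0) : rosenT 1 (1 / 2) x ∈ Ico (-1 / 2) (1 / 2) := by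
  have h1 := Int.floor_le (|1 / (1 * x)| + 1 - 1 / 2)
  have h2 := Int.lt_floor_add_one (|1 / (1 * x)| + 1 - 1 / 2)
  rw [rosenT_eq hx, rosenD]
  rw [one_mul] at *
  constructor <;> linarith

lemma rosenD_eq_ite {a x : ℝ} (ha0 : 0 ≤ a) (ha1 : a ≤ 1 / 2) (hx : x ≠ 0) :
    rosenD 1 a x =
      if a ≤ rosenT 1 (1 / 2) x then rosenD 1 (1 / 2) x + 1 else rosenD 1 (1 / 2) x := by
  obtain ⟨h1, h2⟩ := rosenT_half_mem hx
  have h3 := rosenT_eq (a := 1 / 2) hx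
  rw [rosenD, Int.floor_eq_iff, one_mul]
  split_ifs <;> push_cast <;> constructor <;> linarith

lemma sign_mul_bound {z : ℝ × ℝ} (hy0 : 0 < z.2) (hy1 : z.2 < gold) :
    -1 < Real.sign z.1 * z.2 := by
  have hg2 := gold_lt_two_thirds
  rcases Real.sign_apply_eq z.1 with h | h | h <;> rw [h] <;> linarith

lemma two_le_rosenD_half {x : ℝ} (hx : x ≠ 0) (h : |x| < 1 / 2) : 2 ≤ rosenD 1 (1 / 2) x := by
  have h0 : 0 < |x| := abs_pos.mpr hx
  have h1 : 2 < |1 / x| := by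
    rw [abs_div, abs_one, lt_div_iff₀ h0]; linarith
  rw [rosenD, Int.le_floor, one_mul]
  push_cast
  linarith

/-- Changing the parameter from `1/2` to `a` amounts to applying `quiltShift` to the image
whenever it leaves the interval for `a`. -/
lemma rosenTT_eq_ite {a : ℝ} (ha0 : 0 ≤ a) (ha1 : a ≤ 1 / 2) {z : ℝ × ℝ} (hx : z.1 ≠ 0)
    (hs : 0 < (rosenD 1 (1 / 2) z.1 : ℝ) + Real.sign z.1 * z.2) :
    rosenTT 1 a z = if a ≤ rosenT 1 (1 / 2) z.1 then quiltShift (rosenTT 1 (1 / 2) z)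
      else rosenTT 1 (1 / 2) z := by
  have hd := rosenD_eq_ite ha0 ha1 hx
  split_ifs at hd ⊢ with h
  · ext
    · simp only [rosenTT, quiltShift, rosenT_eq hx, hd]
      push_cast
      ring
    · simp only [rosenTT, quiltShift, hd, mul_one]
      push_cast
      set s := (rosenD 1 (1 / 2) z.1 : ℝ) + Real.sign z.1 * z.2
      have h1 : (rosenD 1 (1 / 2) z.1 : ℝ) + 1 + Real.sign z.1 * z.2 = s + 1 := by
        simp only [s]; ring
      have h2 : 1 + 1 / s = (s + 1) / s := by field_simp
      rw [h1, h2]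
      field_simp
  · simp only [rosenTT, rosenT_eq hx, hd]

lemma rosenTT_half_notMem_removedBlock {a : ℝ} (ha0 : Real.sqrt 2 - 1 ≤ a) (ha1 : a ≤ 1 / 2)
    {z : ℝ × ℝ} (hx : z.1 ≠ 0) (hxa : z.1 < a) (hy0 : 0 < z.2) (hy1 : z.2 < gold)
    (hy2 : z.1 < 0 → z.2 < gold ^ 2)
    (hs : 0 < (rosenD 1 (1 / 2) z.1 : ℝ) + Real.sign z.1 * z.2) :
    rosenTT 1 (1 / 2) z ∉ removedBlock a := by
  obtain ⟨h1, -⟩ := quilt_parameter_bounds ha0 ha1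
  have hg := gold_sq
  have hg2 := gold_lt_two_thirds
  rintro ⟨⟨k1, k2⟩, k3, k4⟩
  simp only [rosenTT, mul_one] at k1 k2 k3 k4
  rw [lt_div_iff₀ hs] at k3
  rw [div_lt_div_iff₀ hs (by norm_num)] at k4
  rw [rosenT_eq hx] at k2
  set d := rosenD 1 (1 / 2) z.1
  have k3' : (d : ℝ) + Real.sign z.1 * z.2 < 2 + gold := by
    by_contra! h
    have : gold ^ 2 * (2 + gold) ≤ gold ^ 2 * ((d : ℝ) + Real.sign z.1 * z.2) := by gcongr
    nlinarith
  rcases lt_or_gt_of_ne hx with hn | hp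
  · rw [Real.sign_of_neg hn] at k3' k4
    have hd1 : (2 : ℝ) < d := by linarith
    have hd2 : (d : ℝ) < 3 := by linarith [hy2 hn]
    have hd1' : 2 < d := by exact_mod_cast hd1
    have hd2' : d < 3 := by exact_mod_cast hd2
    omega
  · rw [Real.sign_of_pos hp] at k3' k4
    have hd1 : (1 : ℝ) < d := by linarith
    have hd2 : (d : ℝ) < 3 := by linarith
    have hd1' : 1 < d := by exact_mod_cast hd1
    have hd2' : d < 3 := by exact_mod_cast hd2
    have hd : d = 2 := by omega
    rw [hd, abs_of_pos (by positivity), lt_div_iff₀ (by linarith)] at k2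
    push_cast at k2
    have : 1 / z.1 * a < 1 := by linarith
    rw [div_mul_eq_mul_div, one_mul, div_lt_one hp] at this
    linarith

/-- Orbits that have met `removedBlock a` merge with those of their `quiltFlip` images. -/
lemma rosenTT_quiltFlip (a : ℝ) {z : ℝ × ℝ} (hx : 0 < z.1) :
    rosenTT 1 a (quiltFlip z) = rosenTT 1 a z := by
  have h1 : 0 < 1 + z.1 := by linarith
  have hn : -z.1 / (1 + z.1) < 0 := div_neg_of_neg_of_pos (by linarith) h1
  have habs : |1 / (-z.1 / (1 + z.1))| = |1 / z.1| + 1 := by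
    rw [abs_of_pos (one_div_pos.mpr hx), abs_of_neg (one_div_neg.mpr hn)]
    field_simp
  have hd : rosenD 1 a (-z.1 / (1 + z.1)) = rosenD 1 a z.1 + 1 := by
    rw [rosenD, rosenD, one_mul, one_mul, habs, ← Int.floor_add_one]
    congr 1
    ring
  ext
  · simp only [rosenTT, quiltFlip, rosenT_eq hn.ne, rosenT_eq hx.ne', habs, hd]
    push_cast
    ring
  · simp only [rosenTT, quiltFlip, Real.sign_of_neg hn, Real.sign_of_pos hx, hd]
    push_cast
    ring_nf

lemma quilt_rosenTT_of_lt {a : ℝ} (ha0 : Real.sqrt 2 - 1 ≤ a) (ha1 : a ≤ 1 / 2) {z : ℝ × ℝ}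
    (hx0 : -1 / 2 < z.1) (hx : z.1 ≠ 0) (hxa : z.1 < a) (hy0 : 0 < z.2) (hy1 : z.2 < gold)
    (hy2 : z.1 < 0 → z.2 < gold ^ 2) :
    quilt a (rosenTT 1 (1 / 2) z) = rosenTT 1 a z := by
  obtain ⟨h1, -⟩ := quilt_parameter_bounds ha0 ha1
  have hd : (2 : ℝ) ≤ rosenD 1 (1 / 2) z.1 := by
    exact_mod_cast two_le_rosenD_half hx (abs_lt.mpr ⟨by linarith, by linarith⟩)
  have hs : 0 < (rosenD 1 (1 / 2) z.1 : ℝ) + Real.sign z.1 * z.2 := by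
    linarith [sign_mul_bound hy0 hy1]
  have hnot := rosenTT_half_notMem_removedBlock ha0 ha1 hx hxa hy0 hy1 hy2 hs
  rw [rosenTT_eq_ite (by linarith) ha1 hx hs, quilt, if_neg hnot]
  rfl

lemma rosenD_eq_two {a x : ℝ} (h1 : 1 + a ≤ |1 / x|) (h2 : |1 / x| < 2 + a) :
    rosenD 1 a x = 2 := by
  rw [rosenD, Int.floor_eq_iff, one_mul]
  push_cast
  constructor <;> linarith

lemma quilt_rosenTT_of_mem_removedStrip {a : ℝ} (ha0 : Real.sqrt 2 - 1 ≤ a) (ha1 : a ≤ 1 / 2)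
    {z : ℝ × ℝ} (hz : z ∈ removedStrip a) :
    quilt a (rosenTT 1 (1 / 2) z) = rosenTT 1 a (quiltShift z) := by
  obtain ⟨h1, -, h3, -, -⟩ := quilt_parameter_bounds ha0 ha1
  have hg := gold_sq
  have hg1 := half_lt_gold
  obtain ⟨⟨hx1, hx2⟩, hy1, hy2⟩ := hz
  have hx : 0 < z.1 := by linarith
  have hxn : z.1 - 1 < 0 := by linarith
  have habs : |1 / z.1| = 1 / z.1 := abs_of_pos (by positivity)
  have habs' : |1 / (z.1 - 1)| = 1 / (1 - z.1) := by
    rw [abs_of_neg (one_div_neg.mpr hxn), ← one_div_neg_eq_neg_one_div, neg_sub]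
  have hlow : 2 < 1 / z.1 := by rw [lt_div_iff₀ hx]; linarith
  have hupp : 1 / z.1 < 1 / a := one_div_lt_one_div_of_lt (by linarith) hx1
  have hr : (1 - 2 * a) / a = 1 / a - 2 := by
    have : a ≠ 0 := by linarith
    field_simp
  have hd : rosenD 1 (1 / 2) z.1 = 2 :=
    rosenD_eq_two (by linarith) (by linarith)
  have hd' : rosenD 1 a (z.1 - 1) = 2 := by
    apply rosenD_eq_two
    · rw [habs', le_div_iff₀ (by linarith)]
      nlinarith
    · rw [habs', div_lt_iff₀ (by linarith)]
      nlinarith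
  have hT : rosenTT 1 (1 / 2) z = (1 / z.1 - 2, 1 / (2 + z.2)) := by
    simp only [rosenTT, rosenT_eq hx.ne', hd, Real.sign_of_pos hx, habs]
    push_cast
    ring_nf
  have hT' : rosenTT 1 a (quiltShift z)
      = (1 / (1 - z.1) - 2, 1 / (2 - z.2 / (1 + z.2))) := by
    simp only [rosenTT, quiltShift, rosenT_eq hxn.ne, hd', Real.sign_of_neg hxn, habs']
    push_cast
    ring_nf
  have hmem : ((1 / z.1 - 2, 1 / (2 + z.2)) : ℝ × ℝ) ∈ removedBlock a := by
    refine ⟨⟨?_, ?_⟩, ?_, ?_⟩ <;> simp only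
    · linarith
    · linarith
    · rw [lt_div_iff₀ (by linarith)]
      have : gold ^ 2 * (2 + z.2) < gold ^ 2 * (2 + gold) := by gcongr
      nlinarith
    · rw [div_lt_div_iff₀ (by linarith) (by norm_num)]
      linarith
  rw [hT, hT', quilt_of_mem_removedBlock ha0 ha1 hmem]
  have k1 : 1 + (1 / z.1 - 2) = (1 - z.1) / z.1 := by field_simp; ring
  have k2 : 2 - z.2 / (1 + z.2) = (2 + z.2) / (1 + z.2) := by field_simp; ring
  have k3 : 1 - z.1 ≠ 0 := by linarith
  ext <;> simp only [quiltFlip, k1, k2]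
  · field_simp
    ring
  · field_simp
    ring

lemma quilt_rosenTT {a : ℝ} (ha0 : Real.sqrt 2 - 1 ≤ a) (ha1 : a ≤ 1 / 2) {z : ℝ × ℝ}
    (hz : z ∈ removedStrip a ∪ removedBlock a ∪ commonPart a) :
    quilt a (rosenTT 1 (1 / 2) z) = rosenTT 1 a (quilt a z) := by
  have hg1 := half_lt_gold
  rcases hz with (hz | hz) | hz
  · rw [quilt_of_mem_removedStrip hz]
    exact quilt_rosenTT_of_mem_removedStrip ha0 ha1 hz
  · rw [quilt_of_mem_removedBlock ha0 ha1 hz, rosenTT_quiltFlip a hz.1.1]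
    obtain ⟨⟨hx, hx'⟩, hy, hy'⟩ := hz
    have h3 := (quilt_parameter_bounds ha0 ha1).2.2.1
    have hg := sq_nonneg gold
    exact quilt_rosenTT_of_lt ha0 ha1 (by linarith) hx.ne' (by linarith) (by linarith)
      (by linarith) fun h => by linarith
  · rw [quilt_of_mem_commonPart ha0 ha1 hz]
    obtain ⟨k1, k2, k3, k4, k5, k6, -⟩ := bounds_of_mem_commonPart ha0 ha1 hz
    exact quilt_rosenTT_of_lt ha0 ha1 k1 k2 k3 k4 k5 k6

/-- for `q = 3` (so `λ = 1`) and `α ∈ [√2 − 1, 1/2]`, the systems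
`(𝒯_{1/2}, Ω_{1/2}, μ_{1/2})` and `(𝒯_α, Ω_α, μ_α)` are isomorphic. -/
theorem stmt19 (lam : ℝ) (hlam : lam = 2 * Real.cos (Real.pi / 3))
    (a : ℝ) (ha0 : Real.sqrt 2 - 1 ≤ a) (ha1 : a ≤ 1 / 2)
    (l1 r1 : ℝ) (hl1 : l1 = (2 * a - 1) / (1 - a)) (hr1 : r1 = (1 - 2 * a) / a)
    (OmA : Set (ℝ × ℝ))
    (hOmA : OmA =
      Set.Ico (a - 1) l1 ×ˢ Set.Ico (0 : ℝ) (gold ^ 2) ∪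
        Set.Ico l1 r1 ×ˢ (Set.Ico (0 : ℝ) (gold ^ 2) ∪ Set.Ico (1 / 2 : ℝ) gold) ∪
        Set.Ico r1 a ×ˢ Set.Ico (0 : ℝ) gold)
    (mu mu12 muA : Measure (ℝ × ℝ))
    (hmu : mu = volume.withDensity fun z => ENNReal.ofReal (((1 + z.1 * z.2) ^ 2)⁻¹))
    (hmu12 : mu12 = mu.restrict Omega3) (hmuA : muA = mu.restrict OmA) :
    ∃ f f' : ℝ × ℝ → ℝ × ℝ, Measurable f ∧ Measurable f' ∧
      mu12.map f = muA ∧ muA.map f' = mu12 ∧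
      (∀ᵐ z ∂mu12, f' (f z) = z) ∧ (∀ᵐ w ∂muA, f (f' w) = w) ∧
      (∀ᵐ z ∂mu12, f (rosenTT lam (1 / 2) z) = rosenTT lam a (f z)) := by
  obtain rfl : lam = 1 := by rw [hlam, Real.cos_pi_div_three]; norm_num
  have hmu' : mu = rosenMeasure := hmu
  have h12 : mu12 = rosenMeasure.restrict (removedStrip a ∪ removedBlock a ∪ commonPart a) := by
    rw [hmu12, hmu', Measure.restrict_congr_set (Omega3_ae_eq ha0 ha1)]
  have hA : muA = rosenMeasure.restrict (addedStrip a ∪ addedBlock a ∪ commonPart a) := by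
    rw [hmuA, hmu', hOmA, hl1, hr1, Measure.restrict_congr_set (region_ae_eq ha0 ha1)]
  have hmeas : MeasurableSet (removedStrip a ∪ removedBlock a ∪ commonPart a) :=
    ((measurableSet_Ioo.prod measurableSet_Ioo).union
      (measurableSet_Ioo.prod measurableSet_Ioo)).union (measurableSet_commonPart a)
  have hmap : mu12.map (quilt a) = muA := by rw [h12, hA, map_quilt ha0 ha1]
  have hleft : ∀ᵐ z ∂mu12, unquilt (quilt a z) = z := by
    rw [h12]
    exact ae_restrict_of_forall_mem hmeas fun z => unquilt_quilt ha0 ha1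
  refine ⟨quilt a, unquilt, measurable_quilt a, measurable_unquilt, hmap, ?_, hleft, ?_, ?_⟩
  · rw [← hmap, Measure.map_map measurable_unquilt (measurable_quilt a)]
    conv_rhs => rw [← Measure.map_id (μ := mu12)]
    exact Measure.map_congr hleft
  · have hset : MeasurableSet {w | quilt a (unquilt w) = w} :=
      measurableSet_eq_fun ((measurable_quilt a).comp measurable_unquilt) measurable_id
    rw [← hmap, ae_map_iff (measurable_quilt a).aemeasurable hset]
    filter_upwards [hleft] with z hz
    rw [hz]
  · rw [h12]
    exact ae_restrict_of_forall_mem hmeas fun z => quilt_rosenTT ha0 ha1
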